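/- For every finite tree G = (V,E) (a connected simple graph with no cycles), a local encoding of the fermionic modes on G exists with the explicit local dimensions H_k = (ℂ²)^{⊗⌈deg(k)/2⌉} for each vertex k, where deg(k) is the degree of k in G. That is, there exist Hermitian operators Â_{jk} = −Â_{kj} on H = ⊗_{v∈V} H_v supported on {j,k} for each edge (j,k) ∈ E, and Hermitian operators B̂_k supported on {k} for each vertex k ∈ V, such that: all B̂_k pairwise commute; Â_{jk} B̂_l = (−1)^{δ_{jl}+δ_{kl}} B̂_l Â_{jk}; Â_{jk} Â_{lm} = (−1)^{δ_{jl}+δ_{kl}+δ_{jm}+δ_{km}} Â_{lm} Â_{jk}; and Â_{jk}² = B̂_k² = Id. -/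

import Mathlib

open scoped Classical

/-- Basis index set of the tensor product `⊗_v ℂ^{d v}`. -/
abbrev TIdx {V : Type*} (d : V → ℕ) := (v : V) → Fin (d v)

/-- A linear operator `M` on `⊗_v ℂ^{d v}` is supported on `S ⊆ V` if `M = m ⊗ Id`. -/
def SupportedOn {V : Type*} (d : V → ℕ) (S : Set V)
    (M : Matrix (TIdx d) (TIdx d) ℂ) : Prop :=
  ∃ m : Matrix ((v : S) → Fin (d v.1)) ((v : S) → Fin (d v.1)) ℂ,
    ∀ x y : TIdx d, M x y =
      if ∀ v ∉ S, x v = y v then m (fun v => x v.1) (fun v => y v.1) else 0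

/-- Kronecker delta of two vertices, as a natural number exponent. -/
def kdelta {V : Type*} [DecidableEq V] (a b : V) : ℕ := if a = b then 1 else 0

open Matrix in
/-- For every `n` there are `2 * n + 1` pairwise anticommuting Hermitian involutions on
`(ℂ²)^{⊗ n}`. -/
theorem exists_anticommuting_hermitian_involutions (n : ℕ) :
    ∃ c : Fin (2 * n + 1) → Matrix (Fin (2 ^ n)) (Fin (2 ^ n)) ℂ,
      (∀ i, (c i).IsHermitian) ∧ (∀ i, c i * c i = 1) ∧
        ∀ i j, i ≠ j → c i * c j = -(c j * c i) := by
  induction n with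
  | zero =>
    refine ⟨fun _ => 1, fun _ => isHermitian_one, fun _ => mul_one 1, fun i j h => ?_⟩
    exact absurd (Subsingleton.elim (α := Fin 1) i j) h
  | succ n ih =>
    obtain ⟨c, hherm, hsq, hanti⟩ := ih
    let X : Matrix (Fin 2) (Fin 2) ℂ := !![0, 1; 1, 0]
    let Y : Matrix (Fin 2) (Fin 2) ℂ := !![0, -Complex.I; Complex.I, 0]
    let Z : Matrix (Fin 2) (Fin 2) ℂ := !![1, 0; 0, -1]
    have hX : Xᴴ = X := by ext i j; fin_cases i <;> fin_cases j <;> simp [X]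
    have hY : Yᴴ = Y := by ext i j; fin_cases i <;> fin_cases j <;> simp [Y]
    have hZ : Zᴴ = Z := by ext i j; fin_cases i <;> fin_cases j <;> simp [Z]
    have hXX : X * X = 1 := by ext i j; fin_cases i <;> fin_cases j <;> simp [X]
    have hYY : Y * Y = 1 := by ext i j; fin_cases i <;> fin_cases j <;> simp [Y]
    have hZZ : Z * Z = 1 := by ext i j; fin_cases i <;> fin_cases j <;> simp [Z]
    have hXY : X * Y = -(Y * X) := by ext i j; fin_cases i <;> fin_cases j <;> simp [X, Y]
    have hXZ : X * Z = -(Z * X) := by ext i j; fin_cases i <;> fin_cases j <;> simp [X, Z]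
    have hYZ : Y * Z = -(Z * Y) := by ext i j; fin_cases i <;> fin_cases j <;> simp [Y, Z]
    have neg_kron (M : Matrix (Fin 2) (Fin 2) ℂ) (N : Matrix (Fin (2 ^ n)) (Fin (2 ^ n)) ℂ) :
        kroneckerMap (· * ·) (-M) N = -kroneckerMap (· * ·) M N := by ext; simp
    have kron_neg (M : Matrix (Fin 2) (Fin 2) ℂ) (N : Matrix (Fin (2 ^ n)) (Fin (2 ^ n)) ℂ) :
        kroneckerMap (· * ·) M (-N) = -kroneckerMap (· * ·) M N := by ext; simp
    let e : Fin 2 × Fin (2 ^ n) ≃ Fin (2 ^ (n + 1)) :=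
      finProdFinEquiv.trans (finCongr (pow_succ' 2 n).symm)
    let f : Fin (2 * n + 1 + 1 + 1) → Matrix (Fin 2 × Fin (2 ^ n)) (Fin 2 × Fin (2 ^ n)) ℂ :=
      Fin.cons (kronecker Y 1) (Fin.cons (kronecker Z 1) fun i => kronecker X (c i))
    have hf_herm : ∀ i, (f i)ᴴ = f i := by
      intro i
      refine Fin.cases ?_ (fun i => Fin.cases ?_ (fun i => ?_) i) i
      · simp [f, conjTranspose_kronecker, hY]
      · simp [f, conjTranspose_kronecker, hZ]
      · simp [f, conjTranspose_kronecker, hX, (hherm i).eq]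
    have hf_sq : ∀ i, f i * f i = 1 := by
      intro i
      refine Fin.cases ?_ (fun i => Fin.cases ?_ (fun i => ?_) i) i
      · simp [f, ← mul_kronecker_mul, hYY]
      · simp [f, ← mul_kronecker_mul, hZZ]
      · simp [f, ← mul_kronecker_mul, hXX, hsq i]
    have hf_anti : ∀ i j, i ≠ j → f i * f j = -(f j * f i) := by
      intro i j
      refine Fin.cases ?_ (fun i => Fin.cases ?_ (fun i => ?_) i) i <;>
        refine Fin.cases ?_ (fun j => Fin.cases ?_ (fun j => ?_) j) j <;> intro hij
      · exact absurd rfl hij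
      · simp [f, ← mul_kronecker_mul, hYZ, neg_kron]
      · simp [f, ← mul_kronecker_mul, hXY, neg_kron]
      · simp [f, ← mul_kronecker_mul, hYZ, neg_kron]
      · exact absurd rfl hij
      · simp [f, ← mul_kronecker_mul, hXZ, neg_kron]
      · simp [f, ← mul_kronecker_mul, hXY, neg_kron]
      · simp [f, ← mul_kronecker_mul, hXZ, neg_kron]
      · have hij' : i ≠ j := fun h => hij (by rw [h])
        simp [f, ← mul_kronecker_mul, hanti i j hij', kron_neg]
    refine ⟨fun i => reindexAlgEquiv ℂ ℂ e (f i), fun i => ?_, fun i => ?_, fun i j hij => ?_⟩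
    · exact IsHermitian.submatrix (hf_herm i) _
    · rw [← map_mul, hf_sq, map_one]
    · rw [← map_mul, ← map_mul, ← map_neg, hf_anti i j hij]

section ProductOperators

variable {V : Type*} [Fintype V] {d : V → ℕ}

/-- The tensor product operator `⊗_v f v`. -/
def tensorOp (f : (v : V) → Matrix (Fin (d v)) (Fin (d v)) ℂ) :
    Matrix (TIdx d) (TIdx d) ℂ :=
  fun x y => ∏ v, f v (x v) (y v)

theorem tensorOp_one :
    tensorOp (1 : (v : V) → Matrix (Fin (d v)) (Fin (d v)) ℂ) = 1 := by
  ext x y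
  simp only [tensorOp, Pi.one_apply, Matrix.one_apply, Fintype.prod_ite_zero, funext_iff,
    Finset.prod_const_one]

theorem tensorOp_isHermitian {f : (v : V) → Matrix (Fin (d v)) (Fin (d v)) ℂ}
    (hf : ∀ v, (f v).IsHermitian) : (tensorOp f).IsHermitian := by
  ext x y
  simp only [tensorOp, Matrix.conjTranspose_apply, star_prod]
  exact Finset.prod_congr rfl fun v _ => (hf v).apply _ _

theorem SupportedOn.smul {S : Set V} {M : Matrix (TIdx d) (TIdx d) ℂ}
    (hM : SupportedOn d S M) (a : ℂ) : SupportedOn d S (a • M) := by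
  obtain ⟨m, hm⟩ := hM
  refine ⟨a • m, fun x y => ?_⟩
  rw [Matrix.smul_apply, hm]
  split_ifs <;> simp

theorem supportedOn_tensorOp {S : Set V} {f : (v : V) → Matrix (Fin (d v)) (Fin (d v)) ℂ}
    (hf : ∀ v ∉ S, f v = 1) : SupportedOn d S (tensorOp f) := by
  refine ⟨fun x y => ∏ v : S, f v.1 (x v) (y v), fun x y => ?_⟩
  have hsplit := Fintype.prod_subtype_mul_prod_subtype (· ∈ S) fun v => f v (x v) (y v)
  rw [tensorOp, ← hsplit]
  split_ifs with h
  · rw [Finset.prod_eq_one (s := (Finset.univ : Finset {v // v ∉ S})), mul_one]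
    · intro v _
      rw [hf v.1 v.2, h v.1 v.2, Matrix.one_apply_eq]
  · push Not at h
    obtain ⟨v, hv, hne⟩ := h
    rw [Finset.prod_eq_zero (s := (Finset.univ : Finset {v // v ∉ S}))
      (Finset.mem_univ ⟨v, hv⟩) (by rw [hf v hv, Matrix.one_apply_ne hne]), mul_zero]

variable [DecidableEq V]

theorem tensorOp_mul (f g : (v : V) → Matrix (Fin (d v)) (Fin (d v)) ℂ) :
    tensorOp (f * g) = tensorOp f * tensorOp g := by
  ext x y
  simp only [tensorOp, Pi.mul_apply, Matrix.mul_apply, Finset.prod_univ_sum,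
    Fintype.piFinset_univ, Finset.prod_mul_distrib]

/-- The operator acting as `m` on the factor `v` and trivially on the others. -/
def siteOp (v : V) (m : Matrix (Fin (d v)) (Fin (d v)) ℂ) : Matrix (TIdx d) (TIdx d) ℂ :=
  tensorOp (Pi.mulSingle v m)

theorem siteOp_mul (v : V) (m m' : Matrix (Fin (d v)) (Fin (d v)) ℂ) :
    siteOp v (m * m') = siteOp v m * siteOp v m' := by
  rw [siteOp, Pi.mulSingle_mul, tensorOp_mul]; rfl

theorem siteOp_one (v : V) : siteOp v (1 : Matrix (Fin (d v)) (Fin (d v)) ℂ) = 1 := by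
  rw [siteOp, Pi.mulSingle_one, tensorOp_one]

theorem siteOp_neg (v : V) (m : Matrix (Fin (d v)) (Fin (d v)) ℂ) :
    siteOp v (-m) = -siteOp v m := by
  ext x y
  simp only [siteOp, tensorOp, Matrix.neg_apply]
  rw [← Finset.mul_prod_erase _ _ (Finset.mem_univ v),
    ← Finset.mul_prod_erase _ _ (Finset.mem_univ v), ← neg_mul]
  congr 1
  · simp
  · refine Finset.prod_congr rfl fun w hw => ?_
    rw [Pi.mulSingle_eq_of_ne (Finset.ne_of_mem_erase hw),
      Pi.mulSingle_eq_of_ne (Finset.ne_of_mem_erase hw)]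

theorem siteOp_commute {v w : V} (h : v ≠ w) (m : Matrix (Fin (d v)) (Fin (d v)) ℂ)
    (m' : Matrix (Fin (d w)) (Fin (d w)) ℂ) : Commute (siteOp v m) (siteOp w m') := by
  rw [Commute, SemiconjBy, siteOp, siteOp, ← tensorOp_mul, ← tensorOp_mul]
  exact congrArg tensorOp
    (Pi.mulSingle_commute (f := fun v => Matrix (Fin (d v)) (Fin (d v)) ℂ) h m m').eq

theorem siteOp_isHermitian (v : V) {m : Matrix (Fin (d v)) (Fin (d v)) ℂ}
    (hm : m.IsHermitian) : (siteOp v m).IsHermitian := by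
  refine tensorOp_isHermitian fun w => ?_
  by_cases h : w = v
  · subst h
    simpa using hm
  · rw [Pi.mulSingle_eq_of_ne h]
    exact Matrix.isHermitian_one

theorem supportedOn_siteOp (v : V) (m : Matrix (Fin (d v)) (Fin (d v)) ℂ) :
    SupportedOn d {v} (siteOp v m) :=
  supportedOn_tensorOp fun _ hw => Pi.mulSingle_eq_of_ne hw _

theorem supportedOn_siteOp_mul_siteOp (v w : V) (m : Matrix (Fin (d v)) (Fin (d v)) ℂ)
    (m' : Matrix (Fin (d w)) (Fin (d w)) ℂ) :
    SupportedOn d {v, w} (siteOp v m * siteOp w m') := by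
  rw [siteOp, siteOp, ← tensorOp_mul]
  refine supportedOn_tensorOp fun u hu => ?_
  simp only [Set.mem_insert_iff, Set.mem_singleton_iff, not_or] at hu
  rw [Pi.mul_apply, Pi.mulSingle_eq_of_ne hu.1, Pi.mulSingle_eq_of_ne hu.2, mul_one]

end ProductOperators

section SignCommute

variable {R : Type*} [Ring R] [Algebra ℂ R]

/-- `a` and `b` commute up to the sign `(-1) ^ n`. -/
def SignCommute (n : ℕ) (a b : R) : Prop :=
  a * b = ((-1 : ℂ) ^ n) • (b * a)

theorem SignCommute.mul_left {n n' : ℕ} {a a' b : R} (h : SignCommute n a b)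
    (h' : SignCommute n' a' b) : SignCommute (n + n') (a * a') b := by
  unfold SignCommute at *
  rw [mul_assoc, h', mul_smul_comm, ← mul_assoc, h, smul_mul_assoc, smul_smul, mul_assoc,
    pow_add, mul_comm]

theorem SignCommute.mul_right {n n' : ℕ} {a b b' : R} (h : SignCommute n a b)
    (h' : SignCommute n' a b') : SignCommute (n + n') a (b * b') := by
  unfold SignCommute at *
  rw [← mul_assoc, h, smul_mul_assoc, mul_assoc, h', mul_smul_comm, smul_smul, mul_assoc,
    pow_add]

theorem SignCommute.smul_left {n : ℕ} {a b : R} (h : SignCommute n a b) (s : ℂ) :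
    SignCommute n (s • a) b := by
  unfold SignCommute at *
  rw [smul_mul_assoc, h, mul_smul_comm, smul_comm]

theorem SignCommute.smul_right {n : ℕ} {a b : R} (h : SignCommute n a b) (s : ℂ) :
    SignCommute n a (s • b) := by
  unfold SignCommute at *
  rw [mul_smul_comm, h, smul_mul_assoc, smul_comm]

theorem SignCommute.congr {n n' : ℕ} {a b : R} (h : SignCommute n a b)
    (hn : (-1 : ℂ) ^ n = (-1) ^ n') : SignCommute n' a b := by
  unfold SignCommute at *
  rw [h, hn]

end SignCommute

/-- The neighbours of `v` can be labelled injectively by nonzero elements of any `Fin (n + 1)`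
with `G.degree v ≤ n`. -/
theorem SimpleGraph.exists_neighbor_labelling {V : Type*} [Fintype V] [DecidableEq V]
    (G : SimpleGraph V) [DecidableRel G.Adj] (v : V) {n : ℕ} (hn : G.degree v ≤ n) :
    ∃ φ : V → Fin (n + 1), (∀ w, G.Adj v w → φ w ≠ 0) ∧
      ∀ w w', G.Adj v w → G.Adj v w' → φ w = φ w' → w = w' := by
  refine ⟨fun w => if h : w ∈ G.neighborFinset v then
    (Fin.castLE hn ((G.neighborFinset v).equivFin ⟨w, h⟩)).succ else 0, ?_, ?_⟩
  · intro w hw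
    simp only [dif_pos ((G.mem_neighborFinset v w).2 hw)]
    exact Fin.succ_ne_zero _
  · intro w w' hw hw' h
    simp only [dif_pos ((G.mem_neighborFinset v w).2 hw),
      dif_pos ((G.mem_neighborFinset v w').2 hw'), Fin.succ_inj] at h
    exact congrArg Subtype.val
      ((G.neighborFinset v).equivFin.injective (Fin.castLE_injective hn h))

/-- An antisymmetric choice of signs on pairs of distinct elements. -/
theorem exists_antisymmetric_sign (V : Type*) [Finite V] :
    ∃ ε : V → V → ℝ, (∀ j k, j ≠ k → ε k j = -ε j k) ∧ ∀ j k, ε j k * ε j k = 1 := by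
  obtain ⟨n, ⟨e⟩⟩ := Finite.exists_equiv_fin V
  refine ⟨fun j k => if e j < e k then 1 else -1, fun j k hjk => ?_, fun j k => ?_⟩
  · rcases lt_or_gt_of_ne (e.injective.ne hjk) with h | h
    · simp [h, h.not_gt]
    · simp [h, h.not_gt]
  · dsimp only
    split_ifs <;> norm_num

/-- The number of coincidences between two edges and the number of pairs of distinct half-edges
at a common vertex have the same parity. -/
theorem neg_one_pow_halfEdges_eq_kdelta {V : Type*} [DecidableEq V] {j k l m : V}
    (hjk : j ≠ k) (hlm : l ≠ m) :
    (-1 : ℂ) ^ ((if j = l ∧ k ≠ m then 1 else 0) + (if j = m ∧ k ≠ l then 1 else 0) +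
        ((if k = l ∧ j ≠ m then 1 else 0) + (if k = m ∧ j ≠ l then 1 else 0))) =
      (-1) ^ (kdelta j l + kdelta k l + kdelta j m + kdelta k m) := by
  unfold kdelta
  by_cases h1 : j = l <;> by_cases h2 : k = l <;> by_cases h3 : j = m <;>
    by_cases h4 : k = m <;> simp only [h1, h2, h3, h4] <;> simp_all

/-- on any finite tree `G = (V, E)`, a local encoding of the
fermionic modes exists with local Hilbert spaces `H_k = (ℂ²)^{⊗⌈deg k / 2⌉}`,
i.e. of local dimension `2 ^ ⌈deg k / 2⌉` at each vertex `k`. -/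
theorem tree_localEncoding_exists {V : Type*} [Fintype V] [DecidableEq V]
    (G : SimpleGraph V) [DecidableRel G.Adj] (hG : G.IsTree) :
    ∃ (A : V → V →
          Matrix (TIdx fun k => 2 ^ ((G.degree k + 1) / 2))
                 (TIdx fun k => 2 ^ ((G.degree k + 1) / 2)) ℂ)
      (B : V →
          Matrix (TIdx fun k => 2 ^ ((G.degree k + 1) / 2))
                 (TIdx fun k => 2 ^ ((G.degree k + 1) / 2)) ℂ),
      (∀ k, (B k).IsHermitian ∧
          SupportedOn (fun k => 2 ^ ((G.degree k + 1) / 2)) {k} (B k)) ∧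
      (∀ j k, G.Adj j k → (A j k).IsHermitian ∧
          SupportedOn (fun k => 2 ^ ((G.degree k + 1) / 2)) {j, k} (A j k) ∧
          A k j = - A j k) ∧
      (∀ j k, B j * B k = B k * B j) ∧
      (∀ j k l, G.Adj j k →
          A j k * B l = ((-1 : ℂ) ^ (kdelta j l + kdelta k l)) • (B l * A j k)) ∧
      (∀ j k l m, G.Adj j k → G.Adj l m →
          A j k * A l m =
            ((-1 : ℂ) ^ (kdelta j l + kdelta k l + kdelta j m + kdelta k m)) •
              (A l m * A j k)) ∧
      (∀ j k, G.Adj j k → A j k ^ 2 = 1) ∧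
      (∀ k, B k ^ 2 = 1) := by
  set d : V → ℕ := fun k => 2 ^ ((G.degree k + 1) / 2)
  choose c hherm hsq hanti using fun v : V =>
    exists_anticommuting_hermitian_involutions ((G.degree v + 1) / 2)
  choose φ hφ0 hφ using fun v : V => G.exists_neighbor_labelling v
    (n := 2 * ((G.degree v + 1) / 2)) (by omega)
  obtain ⟨ε, hε, hεsq⟩ := exists_antisymmetric_sign V
  let g (v : V) (i : Fin (2 * ((G.degree v + 1) / 2) + 1)) : Matrix (TIdx d) (TIdx d) ℂ :=
    siteOp v (c v i)
  have hg_herm v i : (g v i).IsHermitian := siteOp_isHermitian v (hherm v i)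
  have hg_sq v i : g v i * g v i = 1 := by
    simp only [g]
    rw [← siteOp_mul, hsq, siteOp_one]
  have hg_comm {v w : V} (h : v ≠ w) i j : g v i * g w j = g w j * g v i :=
    siteOp_commute h _ _
  have hg_anti {v : V} {i j} (h : i ≠ j) : g v i * g v j = -(g v j * g v i) := by
    simp only [g]
    rw [← siteOp_mul, ← siteOp_mul, hanti v i j h, siteOp_neg]
  -- the sign between a half-edge operator and an on-site parity operator
  have hgB {j k : V} (l : V) (hjk : G.Adj j k) :
      SignCommute (kdelta j l) (g j (φ j k)) (g l 0) := by
    unfold SignCommute kdelta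
    split_ifs with h
    · subst h
      rw [hg_anti (hφ0 _ _ hjk), pow_one, neg_one_smul]
    · rw [hg_comm h, pow_zero, one_smul]
  -- the sign between two half-edge operators
  have hgg {j k l m : V} (hjk : G.Adj j k) (hlm : G.Adj l m) :
      SignCommute (if j = l ∧ k ≠ m then 1 else 0) (g j (φ j k)) (g l (φ l m)) := by
    unfold SignCommute
    by_cases h : j = l
    · subst h
      by_cases hkm : k = m
      · subst hkm
        simp
      · rw [hg_anti fun h => hkm (hφ j k m hjk hlm h)]
        simp [hkm]
    · rw [hg_comm h]
      simp [h]
  have hAsq {j k : V} (h : j ≠ k) (a b) :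
      g j a * g k b * (g j a * g k b) = 1 := by
    rw [mul_assoc, ← mul_assoc (g k b), hg_comm h.symm, mul_assoc, hg_sq, mul_one, hg_sq]
  refine ⟨fun j k => (ε j k : ℂ) • (g j (φ j k) * g k (φ k j)), fun k => g k 0,
    fun k => ⟨hg_herm k 0, supportedOn_siteOp k _⟩, fun j k hjk => ⟨?_, ?_, ?_⟩, fun j k => ?_,
    fun j k l hjk => ?_, fun j k l m hjk hlm => ?_, fun j k hjk => ?_, fun k => ?_⟩
  · rw [Matrix.IsHermitian, Matrix.conjTranspose_smul, Matrix.conjTranspose_mul,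
      (hg_herm _ _).eq, (hg_herm _ _).eq, hg_comm hjk.ne.symm]
    simp
  · exact (supportedOn_siteOp_mul_siteOp j k _ _).smul _
  · dsimp only
    rw [hε j k hjk.ne, hg_comm hjk.ne, Complex.ofReal_neg, neg_smul]
  · by_cases h : j = k
    · rw [h]
    · exact hg_comm h _ _
  · exact ((hgB l hjk).mul_left (hgB l hjk.symm)).smul_left _
  · exact ((((hgg hjk hlm).mul_right (hgg hjk hlm.symm)).mul_left
      ((hgg hjk.symm hlm).mul_right (hgg hjk.symm hlm.symm))).smul_left _ |>.smul_right _).congr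
      (neg_one_pow_halfEdges_eq_kdelta hjk.ne hlm.ne)
  · rw [pow_two, smul_mul_smul_comm, hAsq hjk.ne, ← Complex.ofReal_mul, hεsq]
    simp
  · rw [pow_two, hg_sq]
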